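/- Let A be an M × n complex matrix, let r ≤ min(M, n), and let i₀ be an index of a row of A of maximal Euclidean norm (‖A_{i₀,:}‖₂ ≥ ‖A_{i,:}‖₂ for all i). Then there exists a set S of row indices with |S| = r and i₀ ∈ S such that for every set T of row indices with |T| = r, det(A_T (A_T)ᴴ) ≤ r² · det(A_S (A_S)ᴴ); i.e., there is an r × n row submatrix containing the longest row whose volume is at least 1/r times the maximum volume among all r × n row submatrices. -/

import Mathlib

open Matrix BigOperators

/-- The submatrix of `A` consisting of the rows indexed by the finite set `S`. -/
def rowsSub {M n : ℕ} (A : Matrix (Fin M) (Fin n) ℂ) (S : Finset (Fin M)) :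
    Matrix {x // x ∈ S} (Fin n) ℂ :=
  A.submatrix (fun x : {x // x ∈ S} => (x : Fin M)) id

/-- The squared volume `det(B Bᴴ)` (a nonnegative real) of the row submatrix `A_S`. -/
noncomputable def sqVol {M n : ℕ} (A : Matrix (Fin M) (Fin n) ℂ) (S : Finset (Fin M)) : ℝ :=
  ((rowsSub A S * (rowsSub A S)ᴴ).det).re

open Finset in
lemma norm_dotProduct_sq_le {ι : Type*} [Fintype ι] (x y : ι → ℂ) :
    ‖x ⬝ᵥ y‖ ^ 2 ≤ (∑ i, ‖x i‖ ^ 2) * ∑ i, ‖y i‖ ^ 2 := by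
  calc ‖x ⬝ᵥ y‖ ^ 2 ≤ (∑ i, ‖x i‖ * ‖y i‖) ^ 2 := by
        gcongr
        exact (norm_sum_le _ _).trans_eq (by simp)
    _ ≤ _ := sum_mul_sq_le_sq_mul_sq _ _ _

lemma dotProduct_star_self_eq {ι : Type*} [Fintype ι] (x : ι → ℂ) :
    x ⬝ᵥ star x = ((∑ i, ‖x i‖ ^ 2 : ℝ) : ℂ) := by
  simp [dotProduct, Complex.mul_conj, Complex.normSq_eq_norm_sq]

section

variable {ι κ : Type*} [Fintype ι] [DecidableEq ι] [Fintype κ]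

open scoped ComplexOrder in
lemma det_gram_re_nonneg (B : Matrix ι κ ℂ) : 0 ≤ (B * Bᴴ).det.re :=
  (Complex.nonneg_iff.mp (posSemidef_self_mul_conjTranspose B).det_nonneg).1

lemma adjugate_one_updateRow_col (k : ι) (c : ι → ℂ) (i : ι) :
    adjugate ((1 : Matrix ι ι ℂ).updateRow k c) i k = (1 : Matrix ι ι ℂ) i k := by
  rw [adjugate_apply, updateRow_idem, ← adjugate_apply, adjugate_one]

lemma det_one_updateRow (k : ι) (c : ι → ℂ) :
    ((1 : Matrix ι ι ℂ).updateRow k c).det = c k := by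
  rw [← cramer_transpose_apply, transpose_one, cramer_one, Module.End.one_apply]

lemma det_add_single (H : Matrix ι ι ℂ) (k : ι) (s : ℂ) :
    (H + Matrix.single k k s).det = H.det + s * H.adjugate k k := by
  have h : H + Matrix.single k k s = H.updateRow k (H k + s • Pi.single k 1) := by
    ext i j
    by_cases hi : i = k
    · subst hi
      by_cases hj : j = i
      · subst hj; simp
      · simp [hj, Ne.symm hj]
    · simp [hi, Ne.symm hi]
  rw [h, det_updateRow_add, updateRow_eq_self, det_updateRow_smul, adjugate_apply]

/-- The Gram determinant after replacing row `k` by `c ᵥ* B + w`, where `w` is orthogonal to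
the rows of `B`. -/
lemma det_gram_updateRow (B : Matrix ι κ ℂ) (k : ι) (c : ι → ℂ) (w : κ → ℂ)
    (hw : w ᵥ* Bᴴ = 0) :
    (B.updateRow k (c ᵥ* B + w) * (B.updateRow k (c ᵥ* B + w))ᴴ).det =
      c k * star (c k) * (B * Bᴴ).det + (w ⬝ᵥ star w) * (B * Bᴴ).adjugate k k := by
  set E := (1 : Matrix ι ι ℂ).updateRow k c with hE
  set W : Matrix ι κ ℂ := (0 : Matrix ι κ ℂ).updateRow k w with hW
  have hB : B.updateRow k (c ᵥ* B + w) = E * B + W := by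
    ext i j
    by_cases hi : i = k
    · subst hi; simp [hE, hW, Matrix.mul_apply, vecMul, dotProduct]
    · simp [hE, hW, hi, Matrix.mul_apply, Matrix.one_apply]
  have hWB : W * Bᴴ = 0 := by
    ext i j
    by_cases hi : i = k
    · subst hi
      simpa [hW, Matrix.mul_apply, vecMul, dotProduct] using congrFun hw j
    · simp [hW, hi, Matrix.mul_apply]
  have hBW : B * Wᴴ = 0 := by simpa using congrArg conjTranspose hWB
  have hWW : W * Wᴴ = Matrix.single k k (w ⬝ᵥ star w) := by
    ext i j
    by_cases hi : i = k
    · by_cases hj : j = k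
      · subst hi; subst hj; simp [hW, Matrix.mul_apply, dotProduct]
      · simp [hW, hj, Matrix.mul_apply, Ne.symm hj]
    · simp [hW, hi, Matrix.mul_apply, Ne.symm hi]
  have hprod : (E * B + W) * (E * B + W)ᴴ =
      E * (B * Bᴴ) * Eᴴ + Matrix.single k k (w ⬝ᵥ star w) := by
    rw [conjTranspose_add, conjTranspose_mul, Matrix.add_mul, Matrix.mul_add, Matrix.mul_add,
      ← Matrix.mul_assoc W, hWB, hWW, Matrix.mul_assoc E B Wᴴ, hBW]
    simp [Matrix.mul_assoc]
  have hadj : (E * (B * Bᴴ) * Eᴴ).adjugate k k = (B * Bᴴ).adjugate k k := by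
    rw [adjugate_mul_distrib, adjugate_mul_distrib, ← adjugate_conjTranspose]
    simp [Matrix.mul_apply, hE, adjugate_one_updateRow_col, Matrix.one_apply]
  rw [hB, hprod, det_add_single, hadj, det_mul, det_mul, det_conjTranspose, hE,
    det_one_updateRow]
  ring

/-- A row at least as long as all rows of `B` can replace some row of `B` so that the Gram
determinant shrinks at most by the square of the number of rows. -/
lemma exists_det_gram_le_updateRow [Nonempty ι] (B : Matrix ι κ ℂ) (a : κ → ℂ)
    (ha : ∀ i, ∑ j, ‖B i j‖ ^ 2 ≤ ∑ j, ‖a j‖ ^ 2) (hdet : 0 < (B * Bᴴ).det.re) :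
    ∃ k, (B * Bᴴ).det.re ≤
      (Fintype.card ι : ℝ) ^ 2 * (B.updateRow k a * (B.updateRow k a)ᴴ).det.re := by
  set G := B * Bᴴ with hG
  have hGdet : IsUnit G.det := isUnit_iff_ne_zero.mpr fun h => by simp [h] at hdet
  have hGinv : G⁻¹ * G = 1 := nonsing_inv_mul G hGdet
  have hGH : Gᴴ = G := by simp [hG]
  set c : ι → ℂ := (a ᵥ* Bᴴ) ᵥ* G⁻¹ with hc
  set w : κ → ℂ := a - c ᵥ* B with hw
  have hwB : w ᵥ* Bᴴ = 0 := by
    rw [hw, sub_vecMul, vecMul_vecMul, ← hG, hc, vecMul_vecMul, hGinv, vecMul_one, sub_self]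
  have haw : c ᵥ* B + w = a := by simp [hw]
  set U : Matrix ι κ ℂ := G⁻¹ * B with hU
  have hUB : U * Bᴴ = 1 := by rw [hU, Matrix.mul_assoc, ← hG, hGinv]
  have hUU : U * Uᴴ = G⁻¹ := by
    rw [hU, conjTranspose_mul, ← Matrix.mul_assoc, ← hU, hUB, Matrix.one_mul,
      conjTranspose_nonsing_inv, hGH]
  have hUk (k : ι) : G⁻¹ k k = ((∑ j, ‖U k j‖ ^ 2 : ℝ) : ℂ) := by
    rw [← dotProduct_star_self_eq, ← hUU]
    rfl
  have hdual (k : ι) : 1 ≤ (∑ j, ‖U k j‖ ^ 2) * ∑ j, ‖B k j‖ ^ 2 := by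
    have h1 : U k ⬝ᵥ star (B k) = 1 := by
      have := congrFun (congrFun hUB k) k
      rwa [Matrix.one_apply_eq] at this
    simpa [h1] using norm_dotProduct_sq_le (U k) (star (B k))
  have hadj : G.adjugate = G.det • G⁻¹ := by
    rw [inv_def, smul_smul, Ring.mul_inverse_cancel _ hGdet, one_smul]
  have hvol (k : ι) : (B.updateRow k a * (B.updateRow k a)ᴴ).det.re =
      G.det.re * (‖c k‖ ^ 2 + (∑ j, ‖w j‖ ^ 2) * ∑ j, ‖U k j‖ ^ 2) := by
    have h := det_gram_updateRow B k c w hwB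
    rw [haw, ← hG, hadj, dotProduct_star_self_eq, Matrix.smul_apply, hUk, smul_eq_mul] at h
    have hck : c k * star (c k) = ((‖c k‖ ^ 2 : ℝ) : ℂ) := by
      simp [Complex.mul_conj, Complex.normSq_eq_norm_sq]
    rw [hck] at h
    have h' : (B.updateRow k a * (B.updateRow k a)ᴴ).det =
        ((‖c k‖ ^ 2 + (∑ j, ‖w j‖ ^ 2) * ∑ j, ‖U k j‖ ^ 2 : ℝ) : ℂ) * G.det := by
      rw [h]; push_cast; ring
    rw [h', Complex.re_ofReal_mul, mul_comm]
  have hpyth : ∑ j, ‖a j‖ ^ 2 = ∑ j, ‖(c ᵥ* B) j‖ ^ 2 + ∑ j, ‖w j‖ ^ 2 := by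
    have h1 : w ⬝ᵥ star (c ᵥ* B) = 0 := by
      rw [star_vecMul, dotProduct_mulVec, hwB, zero_dotProduct]
    have h2 : (c ᵥ* B) ⬝ᵥ star w = 0 := by
      rw [dotProduct_star, h1, star_zero]
    have h3 : a ⬝ᵥ star a = (c ᵥ* B) ⬝ᵥ star (c ᵥ* B) + w ⬝ᵥ star w := by
      rw [← haw, star_add, dotProduct_add, add_dotProduct, add_dotProduct, h1, h2]
      ring
    simp only [dotProduct_star_self_eq] at h3
    exact_mod_cast h3
  set L := ∑ j, ‖a j‖ ^ 2 with hL
  set N := ∑ j, ‖w j‖ ^ 2 with hN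
  set r : ℝ := (Fintype.card ι : ℝ) with hr
  have hr1 : 1 ≤ r := Nat.one_le_cast.mpr Fintype.card_pos
  have hN0 : 0 ≤ N := by positivity
  have hspan : ∑ j, ‖(c ᵥ* B) j‖ ^ 2 ≤ (∑ k, ‖c k‖ ^ 2) * (r * L) := by
    calc ∑ j, ‖(c ᵥ* B) j‖ ^ 2
        ≤ ∑ j, (∑ k, ‖c k‖ ^ 2) * ∑ k, ‖B k j‖ ^ 2 :=
          Finset.sum_le_sum fun j _ => norm_dotProduct_sq_le c fun k => B k j
      _ = (∑ k, ‖c k‖ ^ 2) * ∑ k, ∑ j, ‖B k j‖ ^ 2 := by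
          rw [← Finset.mul_sum, Finset.sum_comm]
      _ ≤ (∑ k, ‖c k‖ ^ 2) * ∑ _k : ι, L := by
          gcongr with k
          exact ha k
      _ = _ := by simp [hr]
  have hUL (k : ι) : 1 ≤ (∑ j, ‖U k j‖ ^ 2) * L :=
    (hdual k).trans (by gcongr; exact ha k)
  have hL0 : 0 < L := by
    by_contra! h
    have k := Classical.arbitrary ι
    nlinarith [hUL k, show 0 ≤ ∑ j, ‖U k j‖ ^ 2 by positivity]
  by_contra! hcon
  have hlt (k : ι) : r ^ 2 * (‖c k‖ ^ 2 * L + N) < L := by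
    have h1 := hcon k
    rw [hvol k] at h1
    have h2 : r ^ 2 * (‖c k‖ ^ 2 + N * ∑ j, ‖U k j‖ ^ 2) < 1 := by
      by_contra! h
      nlinarith
    have h3 : N ≤ N * ((∑ j, ‖U k j‖ ^ 2) * L) := le_mul_of_one_le_right hN0 (hUL k)
    calc r ^ 2 * (‖c k‖ ^ 2 * L + N)
        ≤ r ^ 2 * (‖c k‖ ^ 2 * L + N * ((∑ j, ‖U k j‖ ^ 2) * L)) := by gcongr
      _ = r ^ 2 * (‖c k‖ ^ 2 + N * ∑ j, ‖U k j‖ ^ 2) * L := by ring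
      _ < 1 * L := by gcongr
      _ = L := one_mul L
  have hsum : ∑ k, r ^ 2 * (‖c k‖ ^ 2 * L + N) < ∑ _k : ι, L :=
    Finset.sum_lt_sum_of_nonempty Finset.univ_nonempty fun k _ => hlt k
  rw [← Finset.mul_sum, Finset.sum_add_distrib, ← Finset.sum_mul] at hsum
  simp only [Finset.sum_const, Finset.card_univ, nsmul_eq_mul, ← hr] at hsum
  have hsum' : r * ((∑ k, ‖c k‖ ^ 2) * L + r * N) < L := by
    refine lt_of_mul_lt_mul_left ?_ (by positivity : 0 ≤ r)
    linarith
  nlinarith [mul_le_mul_of_nonneg_right (one_le_pow₀ hr1 : 1 ≤ r ^ 2) hN0]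

end

lemma sqVol_nonneg {M n : ℕ} (A : Matrix (Fin M) (Fin n) ℂ) (S : Finset (Fin M)) :
    0 ≤ sqVol A S :=
  det_gram_re_nonneg _

lemma sqVol_image_univ {ι : Type*} [Fintype ι] [DecidableEq ι] {M n : ℕ}
    (A : Matrix (Fin M) (Fin n) ℂ) (f : ι → Fin M) (hf : Function.Injective f) :
    sqVol A (Finset.univ.image f) =
      (A.submatrix f id * (A.submatrix f id)ᴴ).det.re := by
  let e : ι ≃ {x // x ∈ Finset.univ.image f} :=
    (Equiv.ofInjective f hf).trans (Equiv.subtypeEquivRight fun x => by simp)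
  rw [sqVol, ← det_submatrix_equiv_self e]
  rfl

/-- If `i₀` indexes a row of `A` of maximal Euclidean norm, then there is a set `S` of `r`
row indices containing `i₀` such that every set `T` of `r` row indices satisfies
`det(A_T (A_T)ᴴ) ≤ r² · det(A_S (A_S)ᴴ)`; i.e. there is an `r × n` row submatrix containing
the longest row whose volume is at least `1/r` times the maximal volume. -/
theorem statement4 (M n r : ℕ) (hr1 : 1 ≤ r) (hr : r ≤ min M n)
    (A : Matrix (Fin M) (Fin n) ℂ) (i₀ : Fin M)
    (hmax : ∀ i : Fin M, ∑ j, ‖A i j‖ ^ 2 ≤ ∑ j, ‖A i₀ j‖ ^ 2) :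
    ∃ S : Finset (Fin M), S.card = r ∧ i₀ ∈ S ∧
      ∀ T : Finset (Fin M), T.card = r →
        sqVol A T ≤ (r : ℝ) ^ 2 * sqVol A S := by
  obtain ⟨hrM, -⟩ := le_min_iff.mp hr
  have hr1' : (1 : ℝ) ≤ (r : ℝ) ^ 2 := one_le_pow₀ (by exact_mod_cast hr1)
  obtain ⟨T, hT, hTmax⟩ := Finset.exists_max_image
    (Finset.powersetCard r (Finset.univ : Finset (Fin M))) (sqVol A)
    (Finset.powersetCard_nonempty.mpr (by simpa using hrM))
  replace hT : T.card = r := (Finset.mem_powersetCard.mp hT).2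
  replace hTmax (T' : Finset (Fin M)) (h : T'.card = r) : sqVol A T' ≤ sqVol A T :=
    hTmax T' (Finset.mem_powersetCard.mpr ⟨Finset.subset_univ _, h⟩)
  suffices ∃ S : Finset (Fin M), S.card = r ∧ i₀ ∈ S ∧ sqVol A T ≤ (r : ℝ) ^ 2 * sqVol A S by
    obtain ⟨S, hS, hi, hle⟩ := this
    exact ⟨S, hS, hi, fun T' hT' => (hTmax T' hT').trans hle⟩
  by_cases hi : i₀ ∈ T
  · exact ⟨T, hT, hi, le_mul_of_one_le_left (sqVol_nonneg A T) hr1'⟩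
  rcases (sqVol_nonneg A T).eq_or_lt with h0 | hpos
  · obtain ⟨S, hS, hSr⟩ := Finset.exists_superset_card_eq (s := {i₀}) (n := r)
      (by simpa using hr1) (by simpa using hrM)
    refine ⟨S, hSr, hS (by simp), ?_⟩
    rw [← h0]
    exact mul_nonneg (by positivity) (sqVol_nonneg A S)
  have : Nonempty {x // x ∈ T} := (Finset.card_pos.mp (by omega)).to_subtype
  obtain ⟨k, hk⟩ := exists_det_gram_le_updateRow (rowsSub A T) (A i₀) (fun i => hmax i) hpos
  let f : {x // x ∈ T} → Fin M := Function.update Subtype.val k i₀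
  have hf : Function.Injective f := by
    intro x y (hxy : Function.update Subtype.val k i₀ x = Function.update Subtype.val k i₀ y)
    by_cases hx : x = k <;> by_cases hy : y = k
    · rw [hx, hy]
    · rw [hx, Function.update_self, Function.update_of_ne hy] at hxy
      exact absurd (hxy ▸ y.2) hi
    · rw [hy, Function.update_self, Function.update_of_ne hx] at hxy
      exact absurd (hxy ▸ x.2) hi
    · rw [Function.update_of_ne hx, Function.update_of_ne hy] at hxy
      exact Subtype.ext hxy
  have hfA : A.submatrix f id = (rowsSub A T).updateRow k (A i₀) := by
    ext i j
    by_cases h : i = k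
    · subst h; simp [f]
    · simp [f, h, rowsSub]
  refine ⟨Finset.univ.image f, ?_, Finset.mem_image.mpr ⟨k, by simp [f]⟩, ?_⟩
  · rw [Finset.card_image_of_injective _ hf, Finset.card_univ, Fintype.card_coe, hT]
  · rw [sqVol_image_univ A f hf, hfA]
    rwa [Fintype.card_coe, hT] at hk
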